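/- Let r ≥ 1 and let S = (P₁, …, P_{r−1}, I) be a rank r−1 incidence structure. Then there exists a characteristic function χ : ℕ³ → ℤ with parameters r, d = 3 such that S_χ is equivalent to S, if and only if S is equivalent to a rank r−1 incidence structure (P₁, …, P_{r−1}, I′) for which there exist subsets S_p ⊆ ℝ², one for each p ∈ ⋃ᵢ Pᵢ, each homeomorphic to the closed interval [0,1], such that S_p ∩ S_q = ∅ whenever p ≠ q lie in the same part Pᵢ, and such that for p ∈ Pᵢ, q ∈ Pⱼ with i < j one has (p, q) ∈ I′ if and only if S_p ∩ S_q ≠ ∅. -/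

import Mathlib

/-- Two points of `ℕ^d` are *adjacent*: they agree in all but one coordinate,
where they differ by exactly `1`. -/
def GridAdj {d : ℕ} (a b : Fin d → ℕ) : Prop :=
  ∃ j : Fin d, (∀ i : Fin d, i ≠ j → a i = b i) ∧ (a j = b j + 1 ∨ b j = a j + 1)

/-- The connected component of `a` inside the level set `χ⁻¹({χ a})`:
all points reachable from `a` by paths of adjacent points on which `χ` keeps the value `χ a`. -/
def CompOf {d : ℕ} (χ : (Fin d → ℕ) → ℤ) (a : Fin d → ℕ) : Set (Fin d → ℕ) :=
  {b | Relation.ReflTransGen (fun x y => GridAdj x y ∧ χ x = χ a ∧ χ y = χ a) a b}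

/-- `P_χ`: the set of connected components of the level sets `χ⁻¹({r - i})` for `1 ≤ i ≤ r - 1`,
i.e. components of level sets whose value lies in `[1, r-1]`. -/
def Pchi {d : ℕ} (r : ℕ) (χ : (Fin d → ℕ) → ℤ) : Set (Set (Fin d → ℕ)) :=
  {p | ∃ a : Fin d → ℕ, 1 ≤ χ a ∧ χ a ≤ (r : ℤ) - 1 ∧ p = CompOf χ a}

/-- The incidence relation `I_χ` on components: `(p, q) ∈ I_χ` iff `d(p) < d(q)`
(equivalently, the `χ`-value on `p` exceeds that on `q`) and there are adjacent
`a ∈ p`, `b ∈ q` with `a ≤ b`. -/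
def Ichi {d : ℕ} (χ : (Fin d → ℕ) → ℤ) (p q : Set (Fin d → ℕ)) : Prop :=
  ∃ a ∈ p, ∃ b ∈ q, GridAdj a b ∧ a ≤ b ∧ χ b < χ a

/-- A *characteristic function* with parameters `r, d`: `0 ≤ χ ≤ r`, finite support,
and antitone for the componentwise order on `ℕ^d`. -/
def IsCharFun (r d : ℕ) (χ : (Fin d → ℕ) → ℤ) : Prop :=
  (∀ a, 0 ≤ χ a ∧ χ a ≤ (r : ℤ)) ∧ (Function.support χ).Finite ∧
    ∀ a b : Fin d → ℕ, a ≤ b → χ b ≤ χ a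

/-- A rank `kk` incidence structure: a finite set `P` partitioned by the degree map
`deg : P → {1, …, kk}` together with a relation `I` only relating elements of
strictly increasing degree. -/
structure IncStruct (kk : ℕ) where
  P : Type
  finP : Finite P
  deg : P → ℕ
  deg_pos : ∀ p, 1 ≤ deg p
  deg_le : ∀ p, deg p ≤ kk
  I : P → P → Prop
  I_lt : ∀ p q, I p q → deg p < deg q

/-- The incidence structure `S_χ` associated to a characteristic function `χ`
(with parameters `r, d`) is *equivalent* to the incidence structure `S`:
there is a degree-preserving bijection between `P_χ` and `S.P` under which
`I_χ` and `S.I` have the same transitive closure. -/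
def EquivToSchi {d : ℕ} (r : ℕ) (χ : (Fin d → ℕ) → ℤ) {kk : ℕ} (S : IncStruct kk) : Prop :=
  ∃ e : {p : Set (Fin d → ℕ) // p ∈ Pchi r χ} ≃ S.P,
    (∀ p : {p : Set (Fin d → ℕ) // p ∈ Pchi r χ}, ∀ a ∈ p.1,
      (S.deg (e p) : ℤ) = (r : ℤ) - χ a) ∧
    ∀ p q : {p : Set (Fin d → ℕ) // p ∈ Pchi r χ},
      Relation.TransGen
          (fun u v : {p : Set (Fin d → ℕ) // p ∈ Pchi r χ} => Ichi χ u.1 v.1) p q ↔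
        Relation.TransGen S.I (e p) (e q)

lemma GridAdj.symm' {d : ℕ} {a b : Fin d → ℕ} (h : GridAdj a b) : GridAdj b a := by
  obtain ⟨j, h1, h2⟩ := h
  exact ⟨j, fun i hi => (h1 i hi).symm, h2.symm⟩

lemma self_mem_CompOf {d : ℕ} (χ : (Fin d → ℕ) → ℤ) (a : Fin d → ℕ) : a ∈ CompOf χ a :=
  Relation.ReflTransGen.refl

lemma CompOf_val {d : ℕ} {χ : (Fin d → ℕ) → ℤ} {a b : Fin d → ℕ} (h : b ∈ CompOf χ a) :
    χ b = χ a := by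
  have h' : Relation.ReflTransGen (fun x y => GridAdj x y ∧ χ x = χ a ∧ χ y = χ a) a b := h
  rcases h'.cases_tail with h1 | ⟨c, _, h2⟩
  · rw [h1]
  · exact h2.2.2

lemma CompOf_symm {d : ℕ} {χ : (Fin d → ℕ) → ℤ} {a b : Fin d → ℕ} (h : b ∈ CompOf χ a) :
    a ∈ CompOf χ b := by
  have hv := CompOf_val h
  have h' : Relation.ReflTransGen (fun x y => GridAdj x y ∧ χ x = χ a ∧ χ y = χ a) a b := h
  change Relation.ReflTransGen (fun x y => GridAdj x y ∧ χ x = χ b ∧ χ y = χ b) b a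
  rw [hv]
  clear h hv
  induction h' with
  | refl => exact Relation.ReflTransGen.refl
  | tail _ h2 ih => exact Relation.ReflTransGen.head ⟨h2.1.symm', h2.2.2, h2.2.1⟩ ih

lemma CompOf_trans {d : ℕ} {χ : (Fin d → ℕ) → ℤ} {a b c : Fin d → ℕ} (h : b ∈ CompOf χ a)
    (h2 : c ∈ CompOf χ b) : c ∈ CompOf χ a := by
  have hv := CompOf_val h
  have h2' : Relation.ReflTransGen (fun x y => GridAdj x y ∧ χ x = χ b ∧ χ y = χ b) b c := h2
  rw [hv] at h2'
  exact Relation.ReflTransGen.trans h h2'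

lemma CompOf_eq {d : ℕ} {χ : (Fin d → ℕ) → ℤ} {a b : Fin d → ℕ} (h : b ∈ CompOf χ a) :
    CompOf χ b = CompOf χ a := by
  ext c
  exact ⟨fun hc => CompOf_trans h hc, fun hc => CompOf_trans (CompOf_symm h) hc⟩

lemma CompOf_adj {d : ℕ} {χ : (Fin d → ℕ) → ℤ} {a b : Fin d → ℕ} (h : GridAdj a b)
    (hv : χ b = χ a) : b ∈ CompOf χ a :=
  Relation.ReflTransGen.single ⟨h, rfl, hv⟩

/-- Monotone lattice chains. -/
lemma chain_aux {d r : ℕ} {χ : (Fin d → ℕ) → ℤ} (hχ : ∀ a b : Fin d → ℕ, a ≤ b → χ b ≤ χ a) :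
    ∀ (n : ℕ) (a b : Fin d → ℕ), a ≤ b → ∑ i, b i = ∑ i, a i + n →
      ∀ (ha : CompOf χ a ∈ Pchi r χ) (hb : CompOf χ b ∈ Pchi r χ), 1 ≤ χ b → χ a ≤ (r : ℤ) - 1 →
      Relation.ReflTransGen (fun u v : {p : Set (Fin d → ℕ) // p ∈ Pchi r χ} => Ichi χ u.1 v.1)
        ⟨CompOf χ a, ha⟩ ⟨CompOf χ b, hb⟩ := by
  intro n
  induction n with
  | zero =>
    intro a b hab hs ha hb _ _
    have : a = b := by
      funext i
      have := (Finset.sum_eq_sum_iff_of_le (s := Finset.univ) (f := a) (g := b)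
        (fun i _ => hab i)).1 (by simpa using hs.symm) i (Finset.mem_univ i)
      exact this
    subst this
    exact Relation.ReflTransGen.refl
  | succ n ih =>
    intro a b hab hs ha hb h1 h2
    have hex : ∃ j, a j < b j := by
      by_contra! hcon
      have := Finset.sum_le_sum (s := Finset.univ) (fun i _ => hcon i)
      omega
    obtain ⟨j, hj⟩ := hex
    set a' := Function.update a j (a j + 1) with ha'
    have hs' : ∑ i, a' i = ∑ i, a i + 1 := by
      rw [ha', Finset.sum_update_of_mem (Finset.mem_univ j),
        ← Finset.add_sum_erase Finset.univ a (Finset.mem_univ j)]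
      simp only [Finset.sdiff_singleton_eq_erase]
      omega
    have haa' : a ≤ a' := by
      intro i
      by_cases hi : i = j
      · subst hi; simp [ha']
      · simp [ha', hi]
    have ha'b : a' ≤ b := by
      intro i
      by_cases hi : i = j
      · subst hi; simp [ha']; omega
      · simp [ha', hi]; exact hab i
    have hadj : GridAdj a a' := by
      refine ⟨j, fun i hi => by simp [ha', hi], Or.inr (by simp [ha'])⟩
    have hx1 := hχ _ _ haa'
    have hx2 := hχ _ _ ha'b
    have hm : CompOf χ a' ∈ Pchi r χ := ⟨a', by omega, by omega, rfl⟩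
    have hrest := ih a' b ha'b (by omega) hm hb h1 (by omega)
    by_cases hval : χ a' = χ a
    · have heq : CompOf χ a' = CompOf χ a := CompOf_eq (CompOf_adj hadj hval)
      have : (⟨CompOf χ a, ha⟩ : {p : Set (Fin d → ℕ) // p ∈ Pchi r χ}) = ⟨CompOf χ a', hm⟩ :=
        Subtype.ext heq.symm
      rw [this]; exact hrest
    · refine Relation.ReflTransGen.head ?_ hrest
      exact ⟨a, self_mem_CompOf _ _, a', self_mem_CompOf _ _, hadj, haa', by omega⟩

lemma chain {d r : ℕ} {χ : (Fin d → ℕ) → ℤ} (hχ : ∀ a b : Fin d → ℕ, a ≤ b → χ b ≤ χ a)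
    (p q : {p : Set (Fin d → ℕ) // p ∈ Pchi r χ}) (a b : Fin d → ℕ) (ha : a ∈ p.1) (hb : b ∈ q.1)
    (hab : a ≤ b) :
    Relation.ReflTransGen (fun u v : {p : Set (Fin d → ℕ) // p ∈ Pchi r χ} => Ichi χ u.1 v.1)
      p q := by
  obtain ⟨p, a0, h1, h2, rfl⟩ := p
  obtain ⟨q, b0, h3, h4, rfl⟩ := q
  simp only at ha hb
  have e1 := CompOf_eq ha
  have e2 := CompOf_eq hb
  have v1 := CompOf_val ha
  have v2 := CompOf_val hb
  have hma : CompOf χ a ∈ Pchi r χ := ⟨a, by omega, by omega, rfl⟩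
  have hmb : CompOf χ b ∈ Pchi r χ := ⟨b, by omega, by omega, rfl⟩
  have hs := Finset.sum_le_sum (s := Finset.univ) (fun i _ => hab i)
  have := chain_aux (r := r) hχ (∑ i, b i - ∑ i, a i) a b hab (by omega) hma hmb
    (by omega) (by omega)
  convert this using 1
  · exact Subtype.ext e1.symm
  · exact Subtype.ext e2.symm

/-- A connected open set of the plane minus a finite set is connected. -/
lemma preconnected_diff_finite {E : Type*} [NormedAddCommGroup E] [InnerProductSpace ℝ E]
    (hrank : 1 < Module.rank ℝ E) {U F : Set E} (hU : IsOpen U) (hUc : IsPreconnected U)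
    (hF : F.Finite) : IsPreconnected (U \ F) := by
  have : Nontrivial E := by
    rw [← rank_pos_iff_nontrivial (R := ℝ)]
    exact lt_trans zero_lt_one hrank
  have hne : ∀ z : E, (nhdsWithin z {z}ᶜ).NeBot := fun z => Module.punctured_nhds_neBot ℝ E z
  let R : E → E → Prop := fun a b => ∃ C ⊆ U \ F, IsPreconnected C ∧ a ∈ C ∧ b ∈ C
  have Rtrans : ∀ a b c, R a b → R b c → R a c := by
    rintro a b c ⟨C, hC, hC1, ha, hb⟩ ⟨C', hC', hC1', hb', hc⟩
    exact ⟨C ∪ C', Set.union_subset hC hC', hC1.union b hb hb' hC1', Or.inl ha, Or.inr hc⟩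
  let P : E → E → Prop := fun a b =>
    ∀ᶠ a' in nhdsWithin a {a}ᶜ, ∀ᶠ b' in nhdsWithin b {b}ᶜ, R a' b'
  have Ptrans : ∀ a b c, P a b → P b c → P a c := by
    intro a b c h1 h2
    filter_upwards [h1] with a' ha'
    obtain ⟨b', hb1, hb2⟩ := (ha'.and h2).exists
    filter_upwards [hb2] with c' hc'
    exact Rtrans _ _ _ hb1 hc'
  have local_ball : ∀ z ∈ U, ∃ ρ > 0, ∀ a ∈ Metric.ball z ρ, ∀ b ∈ Metric.ball z ρ,
      a ≠ z → b ≠ z → R a b := by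
    intro z hz
    have ho : IsOpen (U \ (F \ {z})) := hU.sdiff (hF.subset Set.sdiff_subset).isClosed
    obtain ⟨ρ, hρ, hb⟩ := Metric.isOpen_iff.1 ho z ⟨hz, fun h => h.2 rfl⟩
    refine ⟨ρ, hρ, fun a ha b hb' haz hbz => ?_⟩
    refine ⟨Metric.ball z ρ \ {z}, ?_, ?_, ⟨ha, haz⟩, ⟨hb', hbz⟩⟩
    · rintro w ⟨hw, hwz⟩
      have := hb hw
      exact ⟨this.1, fun hwF => this.2 ⟨hwF, hwz⟩⟩
    · have himg : Metric.ball z ρ \ {z} = OpenPartialHomeomorph.univBall z ρ '' {0}ᶜ := by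
        ext w
        constructor
        · rintro ⟨hw, hwz⟩
          rw [← OpenPartialHomeomorph.univBall_target z hρ] at hw
          refine ⟨(OpenPartialHomeomorph.univBall z ρ).symm w, ?_,
            (OpenPartialHomeomorph.univBall z ρ).right_inv hw⟩
          intro h0
          apply hwz
          have h0' : (OpenPartialHomeomorph.univBall z ρ).symm w = 0 := h0
          have := (OpenPartialHomeomorph.univBall z ρ).right_inv hw
          rw [h0', OpenPartialHomeomorph.univBall_apply_zero] at this
          exact this.symm
        · rintro ⟨v, hv, rfl⟩
          have hs : ∀ v, v ∈ (OpenPartialHomeomorph.univBall z ρ).source := by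
            intro v; rw [OpenPartialHomeomorph.univBall_source]; trivial
          constructor
          · rw [← OpenPartialHomeomorph.univBall_target z hρ]
            exact (OpenPartialHomeomorph.univBall z ρ).map_source (hs v)
          · intro h
            apply hv
            have h' : OpenPartialHomeomorph.univBall z ρ v = z := h
            rw [← OpenPartialHomeomorph.univBall_apply_zero z ρ] at h'
            exact (OpenPartialHomeomorph.univBall z ρ).injOn (hs _) (hs _) (by simpa using h')
      rw [himg]
      exact (isConnected_compl_singleton_of_one_lt_rank hrank 0).isPreconnected.image _
        (OpenPartialHomeomorph.continuous_univBall z ρ).continuousOn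
  have near : ∀ (z : E) (ρ : ℝ), ∀ a ∈ Metric.ball z ρ,
      ∀ᶠ a' in nhdsWithin a {a}ᶜ, a' ∈ Metric.ball z ρ ∧ a' ≠ z := by
    intro z ρ a ha
    refine Filter.Eventually.and ?_ ?_
    · exact mem_nhdsWithin_of_mem_nhds (Metric.isOpen_ball.mem_nhds ha)
    · by_cases h : a = z
      · subst h
        exact self_mem_nhdsWithin
      · exact mem_nhdsWithin_of_mem_nhds (isOpen_ne.mem_nhds h)
  have hP : ∀ a ∈ U, ∀ b ∈ U, P a b := by
    intro a ha b hb
    refine hUc.induction₂' P (fun z hz => ?_) (fun x y w _ _ _ h1 h2 => Ptrans _ _ _ h1 h2) ha hb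
    obtain ⟨ρ, hρ, h⟩ := local_ball z hz
    refine mem_nhdsWithin_of_mem_nhds ?_
    filter_upwards [Metric.ball_mem_nhds z hρ] with y hy
    have hz' := Metric.mem_ball_self (x := z) hρ
    constructor
    · filter_upwards [near z ρ z hz'] with a' ha'
      filter_upwards [near z ρ y hy] with b' hb'
      exact h _ ha'.1 _ hb'.1 ha'.2 hb'.2
    · filter_upwards [near z ρ y hy] with a' ha'
      filter_upwards [near z ρ z hz'] with b' hb'
      exact h _ ha'.1 _ hb'.1 ha'.2 hb'.2
  have small : ∀ a ∈ U \ F, ∀ᶠ a' in nhdsWithin a {a}ᶜ, R a a' ∧ R a' a := by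
    intro a ha
    have ho : IsOpen (U \ F) := hU.sdiff hF.isClosed
    obtain ⟨ρ, hρ, hb⟩ := Metric.isOpen_iff.1 ho a ha
    filter_upwards [near a ρ a (Metric.mem_ball_self hρ)] with a' ha'
    have hc : IsPreconnected (Metric.ball a ρ) := (convex_ball a ρ).isPreconnected
    exact ⟨⟨_, hb, hc, Metric.mem_ball_self hρ, ha'.1⟩, ⟨_, hb, hc, ha'.1, Metric.mem_ball_self hρ⟩⟩
  refine isPreconnected_of_forall_pair ?_
  intro a ha b hb
  obtain ⟨a', ha1, ha2⟩ := ((hP a ha.1 b hb.1).and (small a ha)).exists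
  obtain ⟨b', hb1, hb2⟩ := (ha1.and (small b hb)).exists
  obtain ⟨C, h1, h2, h3, h4⟩ := Rtrans _ _ _ (Rtrans _ _ _ ha2.1 hb1) hb2.2
  exact ⟨C, h1, h3, h4, h2⟩

/-- A homeomorphism supported in a ball moving the center to a given point. -/
lemma exists_push {E : Type*} [NormedAddCommGroup E] [NormedSpace ℝ E] [CompleteSpace E]
    (y x : E) (ρ : ℝ) (hx : x ∈ Metric.ball y ρ) :
    ∃ h : E ≃ₜ E, h y = x ∧ ∀ z, z ∉ Metric.ball y ρ → h z = z := by
  have hd : ‖x - y‖ < ρ := by simpa [dist_eq_norm] using hx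
  have hρ : 0 < ρ := lt_of_le_of_lt (norm_nonneg _) hd
  let g : E → E := fun z => z + (max 0 (1 - ‖z - y‖ / ρ)) • (x - y)
  let c : NNReal := ⟨‖x - y‖ / ρ, by positivity⟩
  have hc1 : c < 1 := by
    rw [← NNReal.coe_lt_coe]
    change ‖x - y‖ / ρ < 1
    rw [div_lt_one hρ]; exact hd
  have hg : ApproximatesLinearOn g ((ContinuousLinearEquiv.refl ℝ E : E ≃L[ℝ] E) : E →L[ℝ] E)
      Set.univ c := by
    intro u _ v _
    have e1 : g u - g v - ((ContinuousLinearEquiv.refl ℝ E : E ≃L[ℝ] E) : E →L[ℝ] E) (u - v)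
        = (max 0 (1 - ‖u - y‖ / ρ) - max 0 (1 - ‖v - y‖ / ρ)) • (x - y) := by
      simp only [g, ContinuousLinearEquiv.coe_refl, ContinuousLinearMap.id_apply, sub_smul]
      abel
    rw [e1, norm_smul, Real.norm_eq_abs]
    have h1 : |max 0 (1 - ‖u - y‖ / ρ) - max 0 (1 - ‖v - y‖ / ρ)| ≤ ‖u - v‖ / ρ := by
      have h2 := abs_max_sub_max_le_abs (1 - ‖u - y‖ / ρ) (1 - ‖v - y‖ / ρ) 0
      rw [max_comm _ (0:ℝ), max_comm _ (0:ℝ)] at h2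
      refine h2.trans ?_
      have h3 : (1 - ‖u - y‖ / ρ) - (1 - ‖v - y‖ / ρ) = (‖v - y‖ - ‖u - y‖) / ρ := by ring
      rw [h3, abs_div, abs_of_pos hρ]
      have h4 := abs_norm_sub_norm_le (v - y) (u - y)
      have h5 : (v - y) - (u - y) = -(u - v) := by abel
      rw [h5, norm_neg] at h4
      gcongr
    calc _ ≤ ‖u - v‖ / ρ * ‖x - y‖ := by gcongr
      _ = ‖x - y‖ / ρ * ‖u - v‖ := by ring
      _ = (c : ℝ) * ‖u - v‖ := rfl
  have hN : Subsingleton E ∨ c < ‖((ContinuousLinearEquiv.refl ℝ E).symm : E →L[ℝ] E)‖₊⁻¹ := by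
    rcases subsingleton_or_nontrivial E with h | h
    · exact Or.inl h
    · right
      have : ‖((ContinuousLinearEquiv.refl ℝ E).symm : E →L[ℝ] E)‖₊ = 1 := by
        ext
        simp
      rw [this]; simpa using hc1
  refine ⟨ApproximatesLinearOn.toHomeomorph g hg hN, ?_, ?_⟩
  · change g y = x
    simp [g]
  · intro z hz
    change g z = z
    have : ρ ≤ ‖z - y‖ := by simpa [dist_eq_norm] using hz
    have h2 : 1 - ‖z - y‖ / ρ ≤ 0 := by
      rw [sub_nonpos, one_le_div hρ]; exact this
    simp [g, max_eq_left h2]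

lemma exists_move {E : Type*} [NormedAddCommGroup E] [NormedSpace ℝ E] [CompleteSpace E]
    {V : Set E} (hV : IsOpen V) (hVc : IsPreconnected V) {a b : E} (ha : a ∈ V) (hb : b ∈ V) :
    ∃ h : E ≃ₜ E, h a = b ∧ ∀ z, z ∉ V → h z = z := by
  refine hVc.induction₂' (fun a b => ∃ h : E ≃ₜ E, h a = b ∧ ∀ z, z ∉ V → h z = z)
    (fun z hz => ?_) ?_ ha hb
  · obtain ⟨ρ, hρ, hb⟩ := Metric.isOpen_iff.1 hV z hz
    refine mem_nhdsWithin_of_mem_nhds ?_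
    filter_upwards [Metric.ball_mem_nhds z hρ] with y hy
    obtain ⟨h, h1, h2⟩ := exists_push z y ρ hy
    refine ⟨⟨h, h1, fun w hw => h2 w fun h => hw (hb h)⟩, ⟨h.symm, ?_, fun w hw => ?_⟩⟩
    · rw [← h1]; simp
    · have := h2 w fun h => hw (hb h)
      conv_lhs => rw [← this]
      simp
  · rintro x y z _ _ _ ⟨h1, h2, h3⟩ ⟨k1, k2, k3⟩
    refine ⟨h1.trans k1, by simp [h2, k2], fun w hw => by simp [h3 w hw, k3 w hw]⟩

/-- In a connected open set of the plane, every finite set lies on an arc. -/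
lemma exists_arc {E : Type*} [NormedAddCommGroup E] [InnerProductSpace ℝ E] [CompleteSpace E]
    (hrank : 1 < Module.rank ℝ E) {U : Set E} (hU : IsOpen U) (hUc : IsConnected U)
    {F : Set E} (hF : F.Finite) (hFU : F ⊆ U) :
    ∃ A : Set E, A ⊆ U ∧ F ⊆ A ∧ Nonempty (↥(Set.Icc (0 : ℝ) 1) ≃ₜ ↥A) := by
  have : Nontrivial E := by
    rw [← rank_pos_iff_nontrivial (R := ℝ)]
    exact lt_trans zero_lt_one hrank
  induction F, hF using Set.Finite.induction_on with
  | empty =>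
    obtain ⟨x, hx⟩ := hUc.nonempty
    obtain ⟨ρ, hρ, hb⟩ := Metric.isOpen_iff.1 hU x hx
    obtain ⟨v, hv⟩ := exists_norm_eq E (c := ρ / 2) (by positivity)
    have hv0 : v ≠ 0 := by
      rintro rfl
      simp at hv; linarith
    let f : Set.Icc (0 : ℝ) 1 → E := fun t => x + (t : ℝ) • v
    have hf : Topology.IsClosedEmbedding f := by
      refine Continuous.isClosedEmbedding (by fun_prop) ?_
      intro s t hst
      have h1 : (s : ℝ) • v = (t : ℝ) • v := add_left_cancel hst
      exact Subtype.ext (smul_left_injective ℝ hv0 h1)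
    refine ⟨Set.range f, ?_, Set.empty_subset _, ⟨hf.isEmbedding.toHomeomorph⟩⟩
    rintro _ ⟨t, rfl⟩
    apply hb
    simp only [f, Metric.mem_ball, dist_self_add_left, norm_smul, hv, Real.norm_eq_abs]
    rw [abs_of_nonneg t.2.1]
    nlinarith [t.2.2, t.2.1]
  | @insert x F hx hF ih =>
    obtain ⟨A, hA, hFA, ⟨φ⟩⟩ := ih ((Set.subset_insert _ _).trans hFU)
    have hinf : A.Infinite := by
      have : Infinite (Set.Icc (0 : ℝ) 1) := (Set.Icc_infinite zero_lt_one).to_subtype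
      have : Infinite A := Infinite.of_injective φ φ.injective
      exact Set.infinite_coe_iff.1 this
    obtain ⟨y, hyA, hyF⟩ := (hinf.sdiff hF).nonempty
    obtain ⟨h, h1, h2⟩ := exists_move (V := U \ F) (hU.sdiff hF.isClosed)
      (preconnected_diff_finite hrank hU hUc.isPreconnected hF)
      (a := y) (b := x) ⟨hA hyA, hyF⟩ ⟨hFU (Set.mem_insert _ _), hx⟩
    refine ⟨h '' A, ?_, ?_, ⟨φ.trans (h.image A)⟩⟩
    · rintro _ ⟨w, hw, rfl⟩
      by_contra hcon
      have h3 := h2 (h w) (fun h => hcon h.1)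
      have h4 := h.injective h3
      rw [h4] at hcon
      exact hcon (hA hw)
    · rintro w (rfl | hw)
      · exact ⟨y, hyA, h1⟩
      · exact ⟨w, hFA hw, h2 w fun h => h.2 hw⟩

/-- The open box spanned by the unit cubes at `a` and `b`. -/
def obox (a b : Fin 3 → ℕ) : Set (Fin 3 → ℝ) :=
  Set.pi Set.univ (fun i => Set.Ioo (a i : ℝ) ((b i : ℝ) + 1))

lemma mem_obox {a b : Fin 3 → ℕ} {x : Fin 3 → ℝ} :
    x ∈ obox a b ↔ ∀ i, (a i : ℝ) < x i ∧ x i < (b i : ℝ) + 1 := by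
  simp [obox, Set.mem_pi]

lemma isOpen_obox (a b : Fin 3 → ℕ) : IsOpen (obox a b) :=
  isOpen_set_pi Set.finite_univ (fun _ _ => isOpen_Ioo)

lemma preconn_obox (a b : Fin 3 → ℕ) : IsPreconnected (obox a b) :=
  (convex_pi (fun _ _ => convex_Ioo _ _)).isPreconnected

/-- The open thickening of a set of cubes. -/
def thick (p : Set (Fin 3 → ℕ)) : Set (Fin 3 → ℝ) :=
  {x | ∃ a ∈ p, ∃ b ∈ p, a ≤ b ∧ (a = b ∨ GridAdj a b) ∧ x ∈ obox a b}

lemma isOpen_thick (p : Set (Fin 3 → ℕ)) : IsOpen (thick p) := by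
  rw [isOpen_iff_mem_nhds]
  rintro x ⟨a, ha, b, hb, h1, h2, hx⟩
  filter_upwards [(isOpen_obox a b).mem_nhds hx] with y hy
  exact ⟨a, ha, b, hb, h1, h2, hy⟩

lemma obox_subset_thick {p : Set (Fin 3 → ℕ)} {a b : Fin 3 → ℕ} (ha : a ∈ p) (hb : b ∈ p)
    (h1 : a ≤ b) (h2 : a = b ∨ GridAdj a b) : obox a b ⊆ thick p :=
  fun _ hx => ⟨a, ha, b, hb, h1, h2, hx⟩

lemma GridAdj.le_or {d : ℕ} {a b : Fin d → ℕ} (h : GridAdj a b) : a ≤ b ∨ b ≤ a := by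
  obtain ⟨j, h1, h2 | h2⟩ := h
  · right
    refine Pi.le_def.2 fun i => ?_
    by_cases hi : i = j
    · subst hi; omega
    · exact (h1 i hi).ge
  · left
    refine Pi.le_def.2 fun i => ?_
    by_cases hi : i = j
    · subst hi; omega
    · exact (h1 i hi).le

lemma thick_cell {p : Set (Fin 3 → ℕ)} {x : Fin 3 → ℝ} (hx : x ∈ thick p) :
    ∃ c ∈ p, ∀ i, (c i : ℝ) ≤ x i ∧ x i < (c i : ℝ) + 1 := by
  obtain ⟨a, ha, b, hb, hab, h2, hx⟩ := hx
  rw [mem_obox] at hx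
  rcases h2 with rfl | ⟨j, h3, h4⟩
  · exact ⟨a, ha, fun i => ⟨(hx i).1.le, (hx i).2⟩⟩
  · have h5 : b j = a j + 1 := by
      have : a j ≤ b j := hab j
      omega
    by_cases hc : x j < (b j : ℝ)
    · refine ⟨a, ha, fun i => ⟨(hx i).1.le, ?_⟩⟩
      by_cases hi : i = j
      · subst hi; rw [h5] at hc; push_cast at hc; exact hc
      · rw [h3 i hi]; exact (hx i).2
    · refine ⟨b, hb, fun i => ⟨?_, (hx i).2⟩⟩
      by_cases hi : i = j
      · subst hi; exact not_lt.1 hc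
      · rw [← h3 i hi]; exact (hx i).1.le

/-- The center of a cube. -/
noncomputable def mid (a : Fin 3 → ℕ) : Fin 3 → ℝ := fun i => (a i : ℝ) + 1 / 2

lemma mid_mem {a b c : Fin 3 → ℕ} (h1 : a ≤ c) (h2 : c ≤ b) : mid c ∈ obox a b := by
  rw [mem_obox]
  intro i
  have h3 : (a i : ℝ) ≤ c i := by exact_mod_cast h1 i
  have h4 : (c i : ℝ) ≤ b i := by exact_mod_cast h2 i
  simp only [mid]
  constructor <;> linarith

lemma connected_thick (χ : (Fin 3 → ℕ) → ℤ) (a0 : Fin 3 → ℕ) :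
    IsConnected (thick (CompOf χ a0)) := by
  have key : ∀ c, c ∈ CompOf χ a0 → ∃ C ⊆ thick (CompOf χ a0), mid a0 ∈ C ∧ mid c ∈ C ∧
      IsPreconnected C := by
    intro c hc
    have hc' : Relation.ReflTransGen (fun x y => GridAdj x y ∧ χ x = χ a0 ∧ χ y = χ a0) a0 c := hc
    clear hc
    induction hc' with
    | refl =>
      have h0 := self_mem_CompOf χ a0
      exact ⟨obox a0 a0, obox_subset_thick h0 h0 le_rfl (Or.inl rfl), mid_mem le_rfl le_rfl,
        mid_mem le_rfl le_rfl, preconn_obox _ _⟩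
    | @tail b c hb hbc ih =>
      obtain ⟨C, h1, h2, h3, h4⟩ := ih
      have hbm : b ∈ CompOf χ a0 := hb
      have hcm : c ∈ CompOf χ a0 := Relation.ReflTransGen.tail hb hbc
      rcases hbc.1.le_or with hle | hle
      · refine ⟨C ∪ obox b c, Set.union_subset h1 (obox_subset_thick hbm hcm hle (Or.inr hbc.1)),
          Or.inl h2, Or.inr (mid_mem hle le_rfl), ?_⟩
        exact h4.union (mid b) h3 (mid_mem le_rfl hle) (preconn_obox _ _)
      · refine ⟨C ∪ obox c b,
          Set.union_subset h1 (obox_subset_thick hcm hbm hle (Or.inr hbc.1.symm')),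
          Or.inl h2, Or.inr (mid_mem le_rfl hle), ?_⟩
        exact h4.union (mid b) h3 (mid_mem hle le_rfl) (preconn_obox _ _)
  have h0 := self_mem_CompOf χ a0
  refine ⟨⟨mid a0, obox_subset_thick h0 h0 le_rfl (Or.inl rfl) (mid_mem le_rfl le_rfl)⟩, ?_⟩
  refine isPreconnected_of_forall (mid a0) ?_
  rintro y ⟨a, ha, b, hb, hab, h2, hy⟩
  obtain ⟨C, g1, g2, g3, g4⟩ := key a ha
  exact ⟨C ∪ obox a b, Set.union_subset g1 (obox_subset_thick ha hb hab h2), Or.inl g2, Or.inr hy,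
    g4.union (mid a) g3 (mid_mem le_rfl hab) (preconn_obox _ _)⟩

/-- Projection along `(1,1,1)`. -/
noncomputable def proj3 : (Fin 3 → ℝ) →ₗ[ℝ] EuclideanSpace ℝ (Fin 2) where
  toFun x := !₂[x 0 - x 2, x 1 - x 2]
  map_add' x y := by
    ext i; fin_cases i <;> simp <;> ring
  map_smul' c x := by
    ext i; fin_cases i <;> simp <;> ring

lemma proj3_surj : Function.Surjective proj3 := by
  intro z
  refine ⟨![z 0, z 1, 0], ?_⟩
  ext i; fin_cases i <;> simp [proj3]

lemma proj3_eq {x y : Fin 3 → ℝ} (h : proj3 x = proj3 y) : ∃ t : ℝ, ∀ i, y i = x i + t := by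
  have h0 : x 0 - x 2 = y 0 - y 2 := by
    have := congrArg (fun v : EuclideanSpace ℝ (Fin 2) => v 0) h
    simpa [proj3] using this
  have h1 : x 1 - x 2 = y 1 - y 2 := by
    have := congrArg (fun v : EuclideanSpace ℝ (Fin 2) => v 1) h
    simpa [proj3] using this
  refine ⟨y 2 - x 2, fun i => ?_⟩
  fin_cases i <;> simp <;> linarith

lemma cell_le {a b : Fin 3 → ℕ} {x y : Fin 3 → ℝ}
    (ha : ∀ i, (a i : ℝ) ≤ x i ∧ x i < (a i : ℝ) + 1)
    (hb : ∀ i, (b i : ℝ) ≤ y i ∧ y i < (b i : ℝ) + 1) (h : ∀ i, x i ≤ y i) : a ≤ b := by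
  refine Pi.le_def.2 fun i => ?_
  have h1 : (a i : ℝ) < (b i : ℝ) + 1 := by linarith [(ha i).1, (hb i).2, h i]
  have h2 : a i < b i + 1 := by exact_mod_cast h1
  omega

lemma meet_comparable {p q : Set (Fin 3 → ℕ)}
    (h : (proj3 '' thick p ∩ proj3 '' thick q).Nonempty) :
    ∃ a ∈ p, ∃ b ∈ q, a ≤ b ∨ b ≤ a := by
  obtain ⟨_, ⟨x, hx, rfl⟩, ⟨y, hy, hxy⟩⟩ := h
  obtain ⟨t, ht⟩ := proj3_eq hxy.symm
  obtain ⟨a, ha, ha'⟩ := thick_cell hx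
  obtain ⟨b, hb, hb'⟩ := thick_cell hy
  refine ⟨a, ha, b, hb, ?_⟩
  rcases le_total 0 t with h0 | h0
  · exact Or.inl (cell_le ha' hb' (fun i => by rw [ht i]; linarith))
  · exact Or.inr (cell_le hb' ha' (fun i => by rw [ht i]; linarith))

lemma meet_of_Ichi {χ : (Fin 3 → ℕ) → ℤ} {p q : Set (Fin 3 → ℕ)} (h : Ichi χ p q) :
    (proj3 '' thick p ∩ proj3 '' thick q).Nonempty := by
  obtain ⟨a, ha, b, hb, ⟨j, h1, h2⟩, hle, -⟩ := h
  have h5 : b j = a j + 1 := by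
    have : a j ≤ b j := hle j
    omega
  let x : Fin 3 → ℝ := fun i => (a i : ℝ) + if i = j then 3 / 4 else 1 / 4
  let y : Fin 3 → ℝ := fun i => x i + 1 / 2
  refine ⟨proj3 x, ⟨x, obox_subset_thick ha ha le_rfl (Or.inl rfl) ?_, rfl⟩,
    ⟨y, obox_subset_thick hb hb le_rfl (Or.inl rfl) ?_, ?_⟩⟩
  · rw [mem_obox]
    intro i
    simp only [x]
    split_ifs <;> constructor <;> linarith
  · rw [mem_obox]
    intro i
    simp only [x, y]
    by_cases hi : i = j
    · subst hi
      rw [h5]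
      push_cast
      simp only [if_true]
      constructor <;> linarith
    · rw [← h1 i hi]
      simp only [hi, if_false]
      constructor <;> linarith
  · ext i; fin_cases i <;> simp [proj3, y]

lemma TransGen_lt {kk : ℕ} (S : IncStruct kk) {p q : S.P} (h : Relation.TransGen S.I p q) :
    S.deg p < S.deg q := by
  induction h with
  | single h => exact S.I_lt _ _ h
  | tail _ h ih => exact ih.trans (S.I_lt _ _ h)

lemma direction1 {r : ℕ} (S : IncStruct (r - 1)) (χ : (Fin 3 → ℕ) → ℤ) (hχ : IsCharFun r 3 χ)
    (he : EquivToSchi r χ S) :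
    ∃ I' : S.P → S.P → Prop,
        (∀ p q, I' p q → S.deg p < S.deg q) ∧
        (∀ p q, Relation.TransGen S.I p q ↔ Relation.TransGen I' p q) ∧
        ∃ Str : S.P → Set (EuclideanSpace ℝ (Fin 2)),
          (∀ p, Nonempty (↥(Set.Icc (0 : ℝ) 1) ≃ₜ ↥(Str p))) ∧
          (∀ p q, p ≠ q → S.deg p = S.deg q → Str p ∩ Str q = ∅) ∧
          (∀ p q, S.deg p < S.deg q → (I' p q ↔ (Str p ∩ Str q).Nonempty)) := by
  obtain ⟨e, -, he2⟩ := he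
  have hanti := hχ.2.2
  have := S.finP
  let U : S.P → Set (EuclideanSpace ℝ (Fin 2)) := fun p => proj3 '' thick (e.symm p).1
  have hUo : ∀ p, IsOpen (U p) := fun p =>
    proj3.isOpenMap_of_finiteDimensional proj3_surj _ (isOpen_thick _)
  have hUc : ∀ p, IsConnected (U p) := by
    intro p
    obtain ⟨a, -, -, hp⟩ := (e.symm p).2
    have := connected_thick χ a
    rw [← hp] at this
    exact this.image _ proj3.continuous_of_finiteDimensional.continuousOn
  have hRT : ∀ p q, Relation.ReflTransGen
      (fun u v : {p : Set (Fin 3 → ℕ) // p ∈ Pchi r χ} => Ichi χ u.1 v.1)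
      (e.symm p) (e.symm q) → p = q ∨ Relation.TransGen S.I p q := by
    intro p q h
    rcases Relation.reflTransGen_iff_eq_or_transGen.1 h with h | h
    · left
      exact (e.symm.injective h).symm
    · right
      simpa using (he2 _ _).1 h
  have hmeet : ∀ p q, (U p ∩ U q).Nonempty →
      p = q ∨ Relation.TransGen S.I p q ∨ Relation.TransGen S.I q p := by
    intro p q h
    obtain ⟨a, ha, b, hb, hab | hab⟩ := meet_comparable h
    · rcases hRT p q (chain hanti _ _ a b ha hb hab) with h | h
      · exact Or.inl h
      · exact Or.inr (Or.inl h)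
    · rcases hRT q p (chain hanti _ _ b a hb ha hab) with h | h
      · exact Or.inl h.symm
      · exact Or.inr (Or.inr h)
  have hc : ∀ p q, ∃ c, (U p ∩ U q).Nonempty → c ∈ U p ∩ U q := by
    intro p q
    by_cases h : (U p ∩ U q).Nonempty
    · exact ⟨h.some, fun _ => h.some_mem⟩
    · exact ⟨0, fun h' => absurd h' h⟩
  choose c hc using hc
  let F : S.P → Set (EuclideanSpace ℝ (Fin 2)) := fun p =>
    {z | ∃ q, (U p ∩ U q).Nonempty ∧ (z = c p q ∨ z = c q p)}
  have hFf : ∀ p, (F p).Finite := by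
    intro p
    refine ((Set.finite_range (c p)).union (Set.finite_range (fun q => c q p))).subset ?_
    rintro z ⟨q, -, rfl | rfl⟩
    · exact Or.inl ⟨q, rfl⟩
    · exact Or.inr ⟨q, rfl⟩
  have hFU : ∀ p, F p ⊆ U p := by
    rintro p z ⟨q, h, rfl | rfl⟩
    · exact (hc p q h).1
    · exact (hc q p (by rwa [Set.inter_comm])).2
  have hrank : 1 < Module.rank ℝ (EuclideanSpace ℝ (Fin 2)) := by
    rw [← Module.finrank_eq_rank, finrank_euclideanSpace]
    simp
  choose A hAU hFA hA using fun p => exists_arc hrank (hUo p) (hUc p) (hFf p) (hFU p)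
  have hAA : ∀ p q, (A p ∩ A q).Nonempty ↔ (U p ∩ U q).Nonempty := by
    intro p q
    constructor
    · rintro ⟨z, h1, h2⟩
      exact ⟨z, hAU p h1, hAU q h2⟩
    · intro h
      refine ⟨c p q, hFA p ⟨q, h, Or.inl rfl⟩, hFA q ⟨p, ?_, Or.inr rfl⟩⟩
      rwa [Set.inter_comm]
  refine ⟨fun p q => S.deg p < S.deg q ∧ (A p ∩ A q).Nonempty, fun p q h => h.1, ?_, A, hA, ?_, ?_⟩
  · have hto : ∀ p q, Relation.TransGen S.I p q → Relation.TransGen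
        (fun p q => S.deg p < S.deg q ∧ (A p ∩ A q).Nonempty) p q := by
      intro p q h
      have h' := (he2 (e.symm p) (e.symm q)).2 (by simpa using h)
      have : Relation.TransGen (fun p q => S.deg p < S.deg q ∧ (A p ∩ A q).Nonempty)
          (e (e.symm p)) (e (e.symm q)) := by
        refine Relation.TransGen.lift e ?_ _ _ h'
        intro u v huv
        refine ⟨TransGen_lt S ((he2 u v).1 (Relation.TransGen.single huv)), ?_⟩
        rw [hAA]
        simp only [U, Equiv.symm_apply_apply]
        exact meet_of_Ichi huv
      simpa using this
    intro p q
    refine ⟨hto p q, fun h => ?_⟩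
    have hstep : ∀ p q, (S.deg p < S.deg q ∧ (A p ∩ A q).Nonempty) →
        Relation.TransGen S.I p q := by
      rintro p q ⟨hd, hm⟩
      rcases hmeet p q ((hAA p q).1 hm) with h | h | h
      · subst h; omega
      · exact h
      · have := TransGen_lt S h; omega
    induction h with
    | single h => exact hstep _ _ h
    | tail _ h ih => exact ih.trans (hstep _ _ h)
  · intro p q hpq hd
    by_contra hne
    rcases hmeet p q ((hAA p q).1 (Set.nonempty_iff_ne_empty.2 hne)) with h | h | h
    · exact hpq h
    · have := TransGen_lt S h; omega
    · have := TransGen_lt S h; omega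
  · intro p q hd
    exact ⟨fun h => h.2, fun h => ⟨hd, h⟩⟩

lemma mono_conn {d : ℕ} {χ : (Fin d → ℕ) → ℤ} (hχ : ∀ a b : Fin d → ℕ, a ≤ b → χ b ≤ χ a) :
    ∀ (n : ℕ) (a b : Fin d → ℕ), a ≤ b → ∑ i, b i = ∑ i, a i + n → χ b = χ a →
      b ∈ CompOf χ a := by
  intro n
  induction n with
  | zero =>
    intro a b hab hs _
    have : a = b := by
      funext i
      have := (Finset.sum_eq_sum_iff_of_le (s := Finset.univ) (f := a) (g := b)
        (fun i _ => hab i)).1 (by simpa using hs.symm) i (Finset.mem_univ i)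
      exact this
    subst this
    exact self_mem_CompOf _ _
  | succ n ih =>
    intro a b hab hs h1
    have hex : ∃ j, a j < b j := by
      by_contra! hcon
      have := Finset.sum_le_sum (s := Finset.univ) (fun i _ => hcon i)
      omega
    obtain ⟨j, hj⟩ := hex
    set a' := Function.update a j (a j + 1) with ha'
    have hs' : ∑ i, a' i = ∑ i, a i + 1 := by
      rw [ha', Finset.sum_update_of_mem (Finset.mem_univ j),
        ← Finset.add_sum_erase Finset.univ a (Finset.mem_univ j)]
      simp only [Finset.sdiff_singleton_eq_erase]
      omega
    have haa' : a ≤ a' := by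
      intro i
      by_cases hi : i = j
      · subst hi; simp [ha']
      · simp [ha', hi]
    have ha'b : a' ≤ b := by
      intro i
      by_cases hi : i = j
      · subst hi; simp [ha']; omega
      · simp [ha', hi]; exact hab i
    have hadj : GridAdj a a' := by
      refine ⟨j, fun i hi => by simp [ha', hi], Or.inr (by simp [ha'])⟩
    have hx1 := hχ _ _ haa'
    have hx2 := hχ _ _ ha'b
    exact CompOf_trans (CompOf_adj hadj (by omega)) (ih a' b ha'b (by omega) (by omega))

/-- Planar sets, suitably scaled and positioned, realizing an incidence structure. -/
structure Cfg (r : ℕ) (S : IncStruct (r - 1)) where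
  T : S.P → Set (ℝ × ℝ)
  N : ℕ
  conn : ∀ p, IsPreconnected (T p)
  ne : ∀ p, (T p).Nonempty
  low : ∀ p, ∀ z ∈ T p, 2 ≤ z.1 ∧ 2 ≤ z.2 ∧ z.1 + z.2 + 4 ≤ N
  sep : ∀ p q, ∀ z ∈ T p, ∀ w ∈ T q, |z.1 - w.1| ≤ 4 * r + 3 → |z.2 - w.2| ≤ 4 * r + 3 →
    (T p ∩ T q).Nonempty
  disj : ∀ p q, p ≠ q → S.deg p = S.deg q → T p ∩ T q = ∅

namespace Cfg

variable {r : ℕ} {S : IncStruct (r - 1)} (c : Cfg r S)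

/-- The top cubes of the component of `p`. -/
def AA (p : S.P) : Set (Fin 3 → ℕ) :=
  {a | a 0 + a 1 + a 2 = c.N + 2 * S.deg p ∧
    ∃ z ∈ c.T p, |(a 0 : ℝ) - z.1| ≤ 1 ∧ |(a 1 : ℝ) - z.2| ≤ 1}

/-- The down closure of the top cubes. -/
def DD (p : S.P) : Set (Fin 3 → ℕ) := {x | ∃ a ∈ c.AA p, x ≤ a}

open Classical in
/-- The characteristic function. -/
noncomputable def chi (x : Fin 3 → ℕ) : ℤ :=
  haveI : Fintype S.P := @Fintype.ofFinite S.P S.finP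
  if x 0 + x 1 + x 2 ≤ c.N then (r : ℤ) else
    ((Finset.univ.sup (fun p : S.P => if x ∈ c.DD p then r - S.deg p else 0) : ℕ) : ℤ)

lemma deg_lt (p : S.P) : S.deg p + 1 ≤ r := by
  have := S.deg_le p
  have := S.deg_pos p
  omega

lemma chi_low {x : Fin 3 → ℕ} (h : x 0 + x 1 + x 2 ≤ c.N) : c.chi x = r := by
  simp [chi, h]

lemma chi_bound (x : Fin 3 → ℕ) : 0 ≤ c.chi x ∧ c.chi x ≤ r := by
  unfold chi
  split_ifs with h
  · exact ⟨by positivity, le_rfl⟩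
  · refine ⟨by positivity, ?_⟩
    norm_cast
    refine Finset.sup_le fun p _ => ?_
    split_ifs
    · omega
    · omega

lemma chi_ge {x : Fin 3 → ℕ} {p : S.P} (h : x ∈ c.DD p) : (r : ℤ) - S.deg p ≤ c.chi x := by
  have hd := deg_lt p
  unfold chi
  split_ifs with h1
  · omega
  · let _ : Fintype S.P := @Fintype.ofFinite S.P S.finP
    classical
    have := Finset.le_sup (f := fun p : S.P => if x ∈ c.DD p then r - S.deg p else 0)
      (Finset.mem_univ p)
    simp only [h, if_true] at this
    have h2 : (r : ℤ) - S.deg p = ((r - S.deg p : ℕ) : ℤ) := by omega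
    rw [h2]
    exact_mod_cast this

lemma chi_ex {x : Fin 3 → ℕ} (hN : c.N < x 0 + x 1 + x 2) (h : 1 ≤ c.chi x) :
    ∃ p, x ∈ c.DD p ∧ c.chi x = (r : ℤ) - S.deg p := by
  classical
  let _ : Fintype S.P := @Fintype.ofFinite S.P S.finP
  have hdef : c.chi x =
      ((Finset.univ.sup (fun p : S.P => if x ∈ c.DD p then r - S.deg p else 0) : ℕ) : ℤ) := by
    unfold chi
    rw [if_neg (by omega)]
  have hne : (Finset.univ : Finset S.P).Nonempty := by
    by_contra hcon
    rw [Finset.not_nonempty_iff_eq_empty] at hcon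
    rw [hdef, hcon] at h
    simp at h
  obtain ⟨p, -, hp⟩ := Finset.exists_mem_eq_sup Finset.univ hne
    (fun p : S.P => if x ∈ c.DD p then r - S.deg p else 0)
  rw [hp] at hdef
  by_cases hx : x ∈ c.DD p
  · refine ⟨p, hx, ?_⟩
    rw [hdef]
    simp only [hx, if_true]
    have := deg_lt p
    omega
  · rw [hdef] at h
    simp [hx] at h

lemma le3 {x y : Fin 3 → ℕ} (h : x ≤ y) : x 0 ≤ y 0 ∧ x 1 ≤ y 1 ∧ x 2 ≤ y 2 :=
  ⟨h 0, h 1, h 2⟩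

lemma mk_le3 {x y : Fin 3 → ℕ} (h0 : x 0 ≤ y 0) (h1 : x 1 ≤ y 1) (h2 : x 2 ≤ y 2) : x ≤ y := by
  refine Pi.le_def.2 fun i => ?_
  fin_cases i
  · exact h0
  · exact h1
  · exact h2

lemma DD_mono {x y : Fin 3 → ℕ} {p : S.P} (h : x ≤ y) (hy : y ∈ c.DD p) : x ∈ c.DD p := by
  obtain ⟨a, ha, hya⟩ := hy
  exact ⟨a, ha, h.trans hya⟩

lemma chi_anti (x y : Fin 3 → ℕ) (h : x ≤ y) : c.chi y ≤ c.chi x := by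
  by_cases hx : x 0 + x 1 + x 2 ≤ c.N
  · rw [c.chi_low hx]; exact (c.chi_bound y).2
  · have := le3 h
    by_cases hy : 1 ≤ c.chi y
    · obtain ⟨p, hp, hv⟩ := c.chi_ex (by omega) hy
      rw [hv]
      exact c.chi_ge (c.DD_mono h hp)
    · have := (c.chi_bound x).1
      omega

lemma DD_sum {x : Fin 3 → ℕ} {p : S.P} (h : x ∈ c.DD p) :
    x 0 + x 1 + x 2 ≤ c.N + 2 * S.deg p := by
  obtain ⟨a, ha, hxa⟩ := h
  have := le3 hxa
  have := ha.1
  omega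

lemma isCharFun : IsCharFun r 3 c.chi := by
  refine ⟨c.chi_bound, ?_, c.chi_anti⟩
  refine (Set.finite_Iic (fun _ : Fin 3 => c.N + 2 * r)).subset ?_
  intro x hx
  have hx' : c.chi x ≠ 0 := hx
  have hb := (c.chi_bound x).1
  have hs : x 0 + x 1 + x 2 ≤ c.N + 2 * r := by
    by_cases h : x 0 + x 1 + x 2 ≤ c.N
    · omega
    · obtain ⟨p, hp, -⟩ := c.chi_ex (x := x) (by omega) (by omega)
      have := c.DD_sum hp
      have := deg_lt p
      omega
  exact mk_le3 (by omega) (by omega) (by omega)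

/-- The component of `p`. -/
def CC (p : S.P) : Set (Fin 3 → ℕ) := {x | x ∈ c.DD p ∧ c.chi x = (r : ℤ) - S.deg p}

lemma CC_sum {p : S.P} {x : Fin 3 → ℕ} (h : x ∈ c.CC p) : c.N < x 0 + x 1 + x 2 := by
  by_contra hcon
  have h1 := c.chi_low (x := x) (by omega)
  have h2 := h.2
  have := S.deg_pos p
  omega

lemma near_T {p : S.P} {x : Fin 3 → ℕ} (h : x ∈ c.CC p) :
    ∃ z ∈ c.T p, |(x 0 : ℝ) - z.1| ≤ 2 * r + 1 ∧ |(x 1 : ℝ) - z.2| ≤ 2 * r + 1 := by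
  have hs := c.CC_sum h
  obtain ⟨⟨a, ⟨hsum, z, hz, h0, h1⟩, hxa⟩, -⟩ := h
  obtain ⟨l0, l1, l2⟩ := le3 hxa
  have hd := deg_lt p
  have k0 : a 0 ≤ x 0 + 2 * r := by omega
  have k1 : a 1 ≤ x 1 + 2 * r := by omega
  have k0' : (a 0 : ℝ) ≤ x 0 + 2 * r := by exact_mod_cast k0
  have k1' : (a 1 : ℝ) ≤ x 1 + 2 * r := by exact_mod_cast k1
  have l0' : (x 0 : ℝ) ≤ a 0 := by exact_mod_cast l0
  have l1' : (x 1 : ℝ) ≤ a 1 := by exact_mod_cast l1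
  rw [abs_le] at h0 h1
  have hr0 : (0 : ℝ) ≤ r := by positivity
  refine ⟨z, hz, abs_le.2 ⟨?_, ?_⟩, abs_le.2 ⟨?_, ?_⟩⟩ <;> linarith

lemma adj_near {x y : Fin 3 → ℕ} (h : GridAdj x y) (i : Fin 3) : |(x i : ℝ) - y i| ≤ 1 := by
  obtain ⟨j, h1, h2⟩ := h
  by_cases hi : i = j
  · subst hi
    rcases h2 with h2 | h2 <;> rw [h2] <;> simp
  · rw [h1 i hi]; simp

lemma close {p q : S.P} {x y : Fin 3 → ℕ} (hx : x ∈ c.CC p) (hy : y ∈ c.CC q)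
    (h : x = y ∨ GridAdj x y) : (c.T p ∩ c.T q).Nonempty := by
  obtain ⟨z, hz, z0, z1⟩ := c.near_T hx
  obtain ⟨w, hw, w0, w1⟩ := c.near_T hy
  have hxy : ∀ i, |(x i : ℝ) - y i| ≤ 1 := by
    rcases h with rfl | h
    · intro i; simp
    · exact adj_near h
  have h0 := hxy 0
  have h1 := hxy 1
  rw [abs_le] at z0 z1 w0 w1 h0 h1
  refine c.sep p q z hz w hw (abs_le.2 ⟨?_, ?_⟩) (abs_le.2 ⟨?_, ?_⟩) <;> linarith

lemma CC_unique {p q : S.P} {x y : Fin 3 → ℕ} (hx : x ∈ c.CC p) (hy : y ∈ c.CC q)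
    (h : x = y ∨ GridAdj x y) (hv : c.chi x = c.chi y) : p = q := by
  by_contra hne
  have h1 := c.close hx hy h
  have h2 := c.disj p q hne (by have := hx.2; have := hy.2; omega)
  rw [h2] at h1
  exact Set.not_nonempty_empty h1

lemma AA_DD {p : S.P} {a : Fin 3 → ℕ} (h : a ∈ c.AA p) : a ∈ c.DD p := ⟨a, h, le_rfl⟩

lemma top {p : S.P} {x : Fin 3 → ℕ} (h : x ∈ c.DD p)
    (hs : c.N + 2 * S.deg p ≤ x 0 + x 1 + x 2 + 1) : x ∈ c.CC p := by
  refine ⟨h, ?_⟩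
  have h1 := c.chi_ge h
  have hp := S.deg_pos p
  have hd := deg_lt p
  obtain ⟨q, hq, hv⟩ := c.chi_ex (x := x) (by omega) (by omega)
  have := c.DD_sum hq
  omega

lemma AA_CC {p : S.P} {a : Fin 3 → ℕ} (h : a ∈ c.AA p) : a ∈ c.CC p :=
  c.top (c.AA_DD h) (by have := h.1; omega)

lemma conn_le {p : S.P} {x y : Fin 3 → ℕ} (hx : x ∈ c.CC p) (hy : y ∈ c.CC p) (h : x ≤ y) :
    y ∈ CompOf c.chi x := by
  have hs := Finset.sum_le_sum (s := Finset.univ) (fun i _ => h i)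
  exact mono_conn c.chi_anti (∑ i, y i - ∑ i, x i) x y h (by omega) (by rw [hx.2, hy.2])

lemma step {p : S.P} {a b : Fin 3 → ℕ} (ha : a ∈ c.AA p) (hb : b ∈ c.AA p)
    (hs : c.N + 2 * S.deg p ≤ min (a 0) (b 0) + min (a 1) (b 1) + min (a 2) (b 2) + 1) :
    b ∈ CompOf c.chi a := by
  have h1 : a ⊓ b ∈ c.CC p := c.top ⟨a, ha, inf_le_left⟩ (by simpa using hs)
  exact CompOf_trans (CompOf_symm (c.conn_le h1 (c.AA_CC ha) inf_le_left))
    (c.conn_le h1 (c.AA_CC hb) inf_le_right)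

/-- The standard top cube near a point `z`. -/
noncomputable def ff (p : S.P) (z : ℝ × ℝ) : Fin 3 → ℕ :=
  ![⌊z.1⌋₊, ⌊z.2⌋₊, c.N + 2 * S.deg p - ⌊z.1⌋₊ - ⌊z.2⌋₊]

lemma floor_bd {u : ℝ} (h : 2 ≤ u) : (⌊u⌋₊ : ℝ) ≤ u ∧ u < (⌊u⌋₊ : ℝ) + 1 :=
  ⟨Nat.floor_le (by linarith), Nat.lt_floor_add_one u⟩

lemma mk_AA {p : S.P} {z : ℝ × ℝ} (hz : z ∈ c.T p) {m n : ℕ} (hm : |(m : ℝ) - z.1| ≤ 1)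
    (hn : |(n : ℝ) - z.2| ≤ 1) :
    ![m, n, c.N + 2 * S.deg p - m - n] ∈ c.AA p ∧ m + n ≤ c.N := by
  obtain ⟨l0, l1, l2⟩ := c.low p z hz
  have hm' := abs_le.1 hm
  have hn' := abs_le.1 hn
  have : ((m + n : ℕ) : ℝ) ≤ c.N := by push_cast; linarith
  have h : m + n ≤ c.N := by exact_mod_cast this
  refine ⟨⟨?_, z, hz, ?_, ?_⟩, h⟩
  · simp; omega
  · simpa using hm
  · simpa using hn

lemma conn_ff {p : S.P} {z : ℝ × ℝ} (hz : z ∈ c.T p) {a : Fin 3 → ℕ}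
    (hs : a 0 + a 1 + a 2 = c.N + 2 * S.deg p)
    (h0 : |(a 0 : ℝ) - z.1| ≤ 1) (h1 : |(a 1 : ℝ) - z.2| ≤ 1) :
    c.ff p z ∈ CompOf c.chi a := by
  obtain ⟨l0, l1, l2⟩ := c.low p z hz
  obtain ⟨f0, f0'⟩ := floor_bd l0
  obtain ⟨f1, f1'⟩ := floor_bd l1
  have hf0 : |(⌊z.1⌋₊ : ℝ) - z.1| ≤ 1 := abs_le.2 ⟨by linarith, by linarith⟩
  have hf1 : |(⌊z.2⌋₊ : ℝ) - z.2| ≤ 1 := abs_le.2 ⟨by linarith, by linarith⟩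
  obtain ⟨hb, hb'⟩ := c.mk_AA hz hf0 h1
  obtain ⟨hc, hc'⟩ := c.mk_AA hz hf0 hf1
  have ha : a ∈ c.AA p := ⟨hs, z, hz, h0, h1⟩
  have key : ∀ {k m : ℕ} {u : ℝ}, |(k : ℝ) - u| ≤ 1 → (m : ℝ) ≤ u → u < (m : ℝ) + 1 →
      k ≤ m + 1 ∧ m ≤ k + 1 := by
    intro k m u h1 h2 h3
    rw [abs_le] at h1
    have g1 : (k : ℝ) < ((m + 2 : ℕ) : ℝ) := by push_cast; linarith
    have g2 : (m : ℝ) ≤ ((k + 1 : ℕ) : ℝ) := by push_cast; linarith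
    have g1' : k < m + 2 := by exact_mod_cast g1
    have g2' : m ≤ k + 1 := by exact_mod_cast g2
    omega
  have k0 := key h0 f0 f0'
  have k1 := key h1 f1 f1'
  refine CompOf_trans (c.step ha hb ?_) (c.step hb hc ?_)
  · simp; omega
  · simp [ff]; omega

lemma ff_AA {p : S.P} {z : ℝ × ℝ} (hz : z ∈ c.T p) : c.ff p z ∈ c.AA p := by
  obtain ⟨l0, l1, l2⟩ := c.low p z hz
  obtain ⟨f0, f0'⟩ := floor_bd l0
  obtain ⟨f1, f1'⟩ := floor_bd l1
  exact (c.mk_AA hz (abs_le.2 ⟨by linarith, by linarith⟩) (abs_le.2 ⟨by linarith, by linarith⟩)).1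

lemma floor_near {u : ℝ} (h : 2 ≤ u) : ∀ᶠ v in nhds u, |(⌊v⌋₊ : ℝ) - u| ≤ 1 := by
  have h1 : ((⌈u⌉₊ : ℝ) - 1) < u := by linarith [Nat.ceil_lt_add_one (show 0 ≤ u by linarith)]
  have h2 : u < u + 1 := by linarith
  filter_upwards [lt_mem_nhds h1, gt_mem_nhds h2, lt_mem_nhds (show (0 : ℝ) < u by linarith)]
    with v hv1 hv2 hv0
  have g1 : (⌊v⌋₊ : ℝ) ≤ v := Nat.floor_le hv0.le
  have g2 : ⌈u⌉₊ - 1 ≤ ⌊v⌋₊ := by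
    apply Nat.le_floor
    have : 1 ≤ ⌈u⌉₊ := Nat.one_le_iff_ne_zero.2 (by
      have := Nat.ceil_pos.2 (show 0 < u by linarith)
      omega)
    push_cast [this]
    exact hv1.le
  have g3 : ⌈u⌉₊ ≤ ⌊v⌋₊ + 1 := by omega
  have g4 : (⌈u⌉₊ : ℝ) ≤ (⌊v⌋₊ : ℝ) + 1 := by exact_mod_cast g3
  have g5 := Nat.le_ceil u
  exact abs_le.2 ⟨by linarith, by linarith⟩

lemma conn_ff_ff {p : S.P} {z w : ℝ × ℝ} (hz : z ∈ c.T p) (hw : w ∈ c.T p) :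
    c.ff p w ∈ CompOf c.chi (c.ff p z) := by
  refine (c.conn p).induction₂' (fun z w => c.ff p w ∈ CompOf c.chi (c.ff p z))
    (fun z hz => ?_) (fun x y z _ _ _ h1 h2 => CompOf_trans h1 h2) hz hw
  obtain ⟨l0, l1, l2⟩ := c.low p z hz
  have e0 := (continuous_fst.tendsto z).eventually (floor_near l0)
  have e1 := (continuous_snd.tendsto z).eventually (floor_near l1)
  filter_upwards [mem_nhdsWithin_of_mem_nhds e0, mem_nhdsWithin_of_mem_nhds e1,
    self_mem_nhdsWithin] with w h0 h1 hw
  have := c.conn_ff hz (a := c.ff p w) (c.ff_AA hw).1 (by simpa [ff] using h0)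
    (by simpa [ff] using h1)
  exact ⟨CompOf_symm this, this⟩

lemma conn_CC {p : S.P} {x y : Fin 3 → ℕ} (hx : x ∈ c.CC p) (hy : y ∈ c.CC p) :
    y ∈ CompOf c.chi x := by
  have key : ∀ x ∈ c.CC p, ∃ z ∈ c.T p, c.ff p z ∈ CompOf c.chi x := by
    intro x hx
    obtain ⟨a, ha, hxa⟩ := hx.1
    obtain ⟨hs, z, hz, h0, h1⟩ := ha
    exact ⟨z, hz, CompOf_trans (c.conn_le hx (c.AA_CC ⟨hs, z, hz, h0, h1⟩) hxa)
      (c.conn_ff hz hs h0 h1)⟩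
  obtain ⟨z, hz, h1⟩ := key x hx
  obtain ⟨w, hw, h2⟩ := key y hy
  exact CompOf_trans h1 (CompOf_trans (c.conn_ff_ff hz hw) (CompOf_symm h2))

lemma ex_CC {x : Fin 3 → ℕ} (h1 : 1 ≤ c.chi x) (h2 : c.chi x ≤ (r : ℤ) - 1) :
    ∃ p, x ∈ c.CC p := by
  have : c.N < x 0 + x 1 + x 2 := by
    by_contra hcon
    have := c.chi_low (x := x) (by omega)
    omega
  exact c.chi_ex this h1

lemma CC_eq {p : S.P} {x : Fin 3 → ℕ} (hx : x ∈ c.CC p) : c.CC p = CompOf c.chi x := by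
  have hd := deg_lt p
  have hp := S.deg_pos p
  ext y
  refine ⟨fun hy => c.conn_CC hx hy, fun hy => ?_⟩
  have hy' : Relation.ReflTransGen
    (fun u v => GridAdj u v ∧ c.chi u = c.chi x ∧ c.chi v = c.chi x) x y := hy
  clear hy
  induction hy' with
  | refl => exact hx
  | @tail u v _ huv ih =>
    have hv := hx.2
    obtain ⟨q, hq⟩ := c.ex_CC (x := v) (by omega) (by omega)
    have := c.CC_unique ih hq (Or.inr huv.1) (by omega)
    rw [this]; exact hq

lemma CC_ne (p : S.P) : (c.CC p).Nonempty := by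
  obtain ⟨z, hz⟩ := c.ne p
  exact ⟨_, c.AA_CC (c.ff_AA hz)⟩

lemma CC_mem (p : S.P) : c.CC p ∈ Pchi r c.chi := by
  obtain ⟨x, hx⟩ := c.CC_ne p
  have hd := deg_lt p
  have hp := S.deg_pos p
  have hv := hx.2
  exact ⟨x, by omega, by omega, c.CC_eq hx⟩

lemma CC_bij : Function.Bijective
    (fun p : S.P => (⟨c.CC p, c.CC_mem p⟩ : {p : Set (Fin 3 → ℕ) // p ∈ Pchi r c.chi})) := by
  constructor
  · intro p q h
    have h' : c.CC p = c.CC q := congrArg Subtype.val h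
    obtain ⟨x, hx⟩ := c.CC_ne p
    exact c.CC_unique hx (h' ▸ hx) (Or.inl rfl) rfl
  · rintro ⟨_, x, h1, h2, rfl⟩
    obtain ⟨p, hp⟩ := c.ex_CC h1 h2
    exact ⟨p, Subtype.ext (c.CC_eq hp)⟩

lemma main (I' : S.P → S.P → Prop) (hlt : ∀ p q, I' p q → S.deg p < S.deg q)
    (htr : ∀ p q, Relation.TransGen S.I p q ↔ Relation.TransGen I' p q)
    (hI : ∀ p q, S.deg p < S.deg q → (I' p q ↔ (c.T p ∩ c.T q).Nonempty)) :
    EquivToSchi r c.chi S := by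
  let E := Equiv.ofBijective _ c.CC_bij
  have hE : ∀ p, (E p).1 = c.CC p := fun p => rfl
  refine ⟨E.symm, ?_, ?_⟩
  · intro u a ha
    obtain ⟨p, rfl⟩ := E.surjective u
    rw [Equiv.symm_apply_apply]
    have : a ∈ c.CC p := ha
    have := this.2
    omega
  · intro u v
    rw [htr]
    constructor
    · intro h
      refine Relation.TransGen.lift E.symm ?_ _ _ h
      intro u v huv
      obtain ⟨p, rfl⟩ := E.surjective u
      obtain ⟨q, rfl⟩ := E.surjective v
      change I' (E.symm (E p)) (E.symm (E q))
      rw [Equiv.symm_apply_apply, Equiv.symm_apply_apply]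
      obtain ⟨a, ha, b, hb, hadj, -, hlt'⟩ := huv
      have ha' : a ∈ c.CC p := ha
      have hb' : b ∈ c.CC q := hb
      have h1 := ha'.2
      have h2 := hb'.2
      exact (hI p q (by omega)).2 (c.close ha' hb' (Or.inr hadj))
    · intro h
      have key : ∀ p q, I' p q → Relation.TransGen
          (fun u v : {p : Set (Fin 3 → ℕ) // p ∈ Pchi r c.chi} => Ichi c.chi u.1 v.1)
          (E p) (E q) := by
        intro p q hpq
        have hd := hlt p q hpq
        obtain ⟨z, hz, hz'⟩ := (hI p q hd).1 hpq
        have ha := c.AA_CC (c.ff_AA hz)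
        have hb := c.AA_CC (c.ff_AA hz')
        have hle : c.ff p z ≤ c.ff q z := by
          refine mk_le3 (by simp [ff]) (by simp [ff]) ?_
          simp only [ff, Matrix.cons_val]
          omega
        have := chain c.chi_anti (E p) (E q) _ _ ha hb hle
        rcases Relation.reflTransGen_iff_eq_or_transGen.1 this with h | h
        · have := E.injective h
          subst this
          omega
        · exact h
      have hgen : ∀ p q, Relation.TransGen I' p q → Relation.TransGen
          (fun u v : {p : Set (Fin 3 → ℕ) // p ∈ Pchi r c.chi} => Ichi c.chi u.1 v.1)
          (E p) (E q) := by
        intro p q h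
        induction h with
        | single h => exact key _ _ h
        | tail _ h ih => exact ih.trans (key _ _ h)
      simpa using hgen _ _ h

end Cfg

lemma direction2 {r : ℕ} (S : IncStruct (r - 1)) (I' : S.P → S.P → Prop)
    (hlt : ∀ p q, I' p q → S.deg p < S.deg q)
    (htr : ∀ p q, Relation.TransGen S.I p q ↔ Relation.TransGen I' p q)
    (Str : S.P → Set (EuclideanSpace ℝ (Fin 2)))
    (hS : ∀ p, Nonempty (↥(Set.Icc (0 : ℝ) 1) ≃ₜ ↥(Str p)))
    (hdis : ∀ p q, p ≠ q → S.deg p = S.deg q → Str p ∩ Str q = ∅)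
    (hI : ∀ p q, S.deg p < S.deg q → (I' p q ↔ (Str p ∩ Str q).Nonempty)) :
    ∃ χ : (Fin 3 → ℕ) → ℤ, IsCharFun r 3 χ ∧ EquivToSchi r χ S := by
  have hfin := S.finP
  let φ : EuclideanSpace ℝ (Fin 2) → ℝ × ℝ := fun z => (z 0, z 1)
  have hφ : Continuous φ := by fun_prop
  have hφi : Function.Injective φ := by
    intro z w h
    have h1 := congrArg Prod.fst h
    have h2 := congrArg Prod.snd h
    ext i
    fin_cases i
    · exact h1
    · exact h2
  let K : S.P → Set (ℝ × ℝ) := fun p => φ '' Str p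
  have hStr : ∀ p, IsCompact (Str p) ∧ IsConnected (Str p) := by
    intro p
    obtain ⟨f⟩ := hS p
    have hr : Str p = Set.range (fun t => (f t : EuclideanSpace ℝ (Fin 2))) := by
      have h1 := f.surjective.range_eq
      change _ = Set.range (Subtype.val ∘ f)
      rw [Set.range_comp, h1]; simp
    have hc : Continuous (fun t => (f t : EuclideanSpace ℝ (Fin 2))) :=
      continuous_subtype_val.comp f.continuous
    have : ConnectedSpace (Set.Icc (0 : ℝ) 1) :=
      isConnected_iff_connectedSpace.1 (isConnected_Icc zero_le_one)
    rw [hr]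
    exact ⟨isCompact_range hc, isConnected_range hc⟩
  have hKc : ∀ p, IsCompact (K p) := fun p => (hStr p).1.image hφ
  have hKn : ∀ p, IsConnected (K p) := fun p => (hStr p).2.image _ hφ.continuousOn
  have hKK : ∀ p q, (K p ∩ K q).Nonempty ↔ (Str p ∩ Str q).Nonempty := by
    intro p q
    rw [← Set.image_inter hφi, Set.image_nonempty]
  obtain ⟨B, hB⟩ : ∃ B : ℝ, ∀ p, ∀ z ∈ K p, |z.1| ≤ B ∧ |z.2| ≤ B := by
    have hb : Bornology.IsBounded (⋃ p, K p) :=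
      Bornology.isBounded_iUnion.2 fun p => (hKc p).isBounded
    obtain ⟨B, hB⟩ := hb.exists_norm_le
    refine ⟨B, fun p z hz => ?_⟩
    have h := hB z (Set.mem_iUnion.2 ⟨p, hz⟩)
    rw [Prod.norm_def] at h
    exact ⟨(le_max_left _ _).trans h, (le_max_right _ _).trans h⟩
  have hM : ∀ᶠ M : ℕ in Filter.atTop, ∀ p q, ∀ z ∈ K p, ∀ w ∈ K q,
      (M : ℝ) * dist z w ≤ 4 * r + 3 → (K p ∩ K q).Nonempty := by
    rw [Filter.eventually_all]
    intro p
    rw [Filter.eventually_all]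
    intro q
    by_cases hne : (K p ∩ K q).Nonempty
    · exact Filter.Eventually.of_forall fun M z _ w _ _ => hne
    · have hd : Disjoint (K p) (K q) := by
        rw [Set.disjoint_iff_inter_eq_empty]
        exact Set.not_nonempty_iff_eq_empty.1 hne
      obtain ⟨δ, hδ, hthick⟩ := hd.exists_thickenings (hKc p) (hKc q).isClosed
      have ht : Filter.Tendsto (fun M : ℕ => (M : ℝ) * δ) Filter.atTop Filter.atTop :=
        tendsto_natCast_atTop_atTop.atTop_mul_const hδ
      filter_upwards [ht.eventually_gt_atTop (4 * r + 3 : ℝ)] with M hM z hz w hw hle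
      exfalso
      have h1 : dist z w < δ := by
        by_contra hcon
        have : (M : ℝ) * δ ≤ M * dist z w := by
          gcongr
          exact not_lt.1 hcon
        linarith
      have m1 : w ∈ Metric.thickening δ (K p) :=
        Metric.mem_thickening_iff.2 ⟨z, hz, by rwa [dist_comm]⟩
      have m2 : w ∈ Metric.thickening δ (K q) :=
        Metric.mem_thickening_iff.2 ⟨w, hw, by simpa using hδ⟩
      exact Set.disjoint_left.1 hthick m1 m2
  obtain ⟨M, hM, hM1⟩ := (hM.and (Filter.eventually_ge_atTop 1)).exists
  have hM0 : (0 : ℝ) < M := by exact_mod_cast hM1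
  let g : ℝ × ℝ → ℝ × ℝ := fun z => (M * B + 2 + M * z.1, M * B + 2 + M * z.2)
  have hg : Continuous g := by fun_prop
  have hgi : Function.Injective g := by
    intro z w h
    have h1 := congrArg Prod.fst h
    have h2 := congrArg Prod.snd h
    simp only [g, add_right_inj, mul_right_inj' hM0.ne'] at h1 h2
    exact Prod.ext h1 h2
  have hgK : ∀ p q, (g '' K p ∩ g '' K q).Nonempty ↔ (Str p ∩ Str q).Nonempty := by
    intro p q
    rw [← Set.image_inter hgi, Set.image_nonempty, hKK]
  let c : Cfg r S :=
    { T := fun p => g '' K p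
      N := ⌈4 * (M * B) + 8⌉₊
      conn := fun p => ((hKn p).image _ hg.continuousOn).isPreconnected
      ne := fun p => (hKn p).nonempty.image _
      low := by
        rintro p _ ⟨z, hz, rfl⟩
        obtain ⟨b1, b2⟩ := hB p z hz
        rw [abs_le] at b1 b2
        have e1 : (M : ℝ) * -B ≤ M * z.1 := by gcongr; exact b1.1
        have e2 : (M : ℝ) * -B ≤ M * z.2 := by gcongr; exact b2.1
        have e3 : (M : ℝ) * z.1 ≤ M * B := by gcongr; exact b1.2
        have e4 : (M : ℝ) * z.2 ≤ M * B := by gcongr; exact b2.2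
        have e5 := Nat.le_ceil (4 * (M * B) + 8 : ℝ)
        simp only [g]
        refine ⟨by linarith, by linarith, by linarith⟩
      sep := by
        rintro p q _ ⟨z, hz, rfl⟩ _ ⟨w, hw, rfl⟩ h1 h2
        rw [hgK, ← hKK]
        refine hM p q z hz w hw ?_
        simp only [g] at h1 h2
        have e1 : (M : ℝ) * B + 2 + M * z.1 - (M * B + 2 + M * w.1) = M * (z.1 - w.1) := by ring
        have e2 : (M : ℝ) * B + 2 + M * z.2 - (M * B + 2 + M * w.2) = M * (z.2 - w.2) := by ring
        rw [e1, abs_mul, abs_of_pos hM0] at h1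
        rw [e2, abs_mul, abs_of_pos hM0] at h2
        rw [Prod.dist_eq, Real.dist_eq, Real.dist_eq]
        rcases max_choice |z.1 - w.1| |z.2 - w.2| with h | h <;> rw [h] <;> assumption
      disj := by
        intro p q hpq hd
        rw [← Set.not_nonempty_iff_eq_empty, hgK, Set.not_nonempty_iff_eq_empty]
        exact hdis p q hpq hd }
  refine ⟨c.chi, c.isCharFun, c.main I' hlt htr ?_⟩
  intro p q hd
  rw [hI p q hd]
  exact (hgK p q).symm

/-- Let `r ≥ 1` and let `S` be a rank `r−1` incidence structure.  There is a
characteristic function `χ : ℕ³ → ℤ` with parameters `r, d = 3` such that `S_χ` is equivalent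
to `S`, iff `S` is equivalent to a rank `r−1` incidence structure `(P₁, …, P_{r−1}, I′)` for
which there exist subsets `Str p ⊆ ℝ²`, each homeomorphic to the closed interval `[0,1]`,
with `Str p ∩ Str q = ∅` for distinct `p ≠ q` in the same part, and such that for
`deg p < deg q` one has `(p, q) ∈ I′` iff `Str p ∩ Str q ≠ ∅`. -/
theorem statement8 {r : ℕ} (hr : 1 ≤ r) (S : IncStruct (r - 1)) :
    (∃ χ : (Fin 3 → ℕ) → ℤ, IsCharFun r 3 χ ∧ EquivToSchi r χ S) ↔
      ∃ I' : S.P → S.P → Prop,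
        (∀ p q, I' p q → S.deg p < S.deg q) ∧
        (∀ p q, Relation.TransGen S.I p q ↔ Relation.TransGen I' p q) ∧
        ∃ Str : S.P → Set (EuclideanSpace ℝ (Fin 2)),
          (∀ p, Nonempty (↥(Set.Icc (0 : ℝ) 1) ≃ₜ ↥(Str p))) ∧
          (∀ p q, p ≠ q → S.deg p = S.deg q → Str p ∩ Str q = ∅) ∧
          (∀ p q, S.deg p < S.deg q → (I' p q ↔ (Str p ∩ Str q).Nonempty)) := by
  constructor
  · rintro ⟨χ, hχ, he⟩
    exact direction1 S χ hχ he
  · rintro ⟨I', hlt, htr, Str, hS, hdis, hI⟩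
    exact direction2 S I' hlt htr Str hS hdis hI
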